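/- Let 0 < κ < 1/4 and let r₁ ≤ r₂ < 0 < 2√κ < r₃ be real numbers with r₁ < r₂. Then ∫_{2√κ}^{r₃} dz/√(-z(z-2√κ)(z-r₁)(z-r₂)(z-r₃)) < ∫_{r₂}^{0} dz/√(-z(z-2√κ)(z-r₁)(z-r₂)(z-r₃)), i.e. the half-period ℳ of the s-oscillation is strictly smaller than the half-period 𝒩 of the t-oscillation. -/

import Mathlib

open MeasureTheory Set

/-- The Möbius involution exchanging `0` with `a` and `b` with `c`. -/
noncomputable def swapMap (a b c w : ℝ) : ℝ := b * c * (a - w) / ((a - b - c) * w + b * c)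

section swapMap

variable {a b c w : ℝ}

lemma swapMap_denom_neg_left (ha : 0 < a) (hb : b < 0) (hc : a < c) (hw : w ∈ Ioo b 0) :
    (a - b - c) * w + b * c < 0 := by
  obtain ⟨h1, h2⟩ := hw
  have e : b * ((a - b - c) * w + b * c) = w * (b * (a - b)) + (b - w) * (b * c) := by ring
  have p1 : 0 < w * (b * (a - b)) := mul_pos_of_neg_of_neg h2 (by nlinarith)
  have p2 : 0 < (b - w) * (b * c) := mul_pos_of_neg_of_neg (by linarith) (by nlinarith)
  nlinarith

lemma swapMap_denom_neg_right (ha : 0 < a) (hb : b < 0) (hw : w ∈ Ioo a c) :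
    (a - b - c) * w + b * c < 0 := by
  obtain ⟨h1, h2⟩ := hw
  have e : (a - b - c) * w + b * c = w * (a - c) + b * (c - w) := by ring
  have p1 : w * (a - c) < 0 := mul_neg_of_pos_of_neg (by linarith) (by linarith)
  have p2 : b * (c - w) < 0 := mul_neg_of_neg_of_pos hb (by linarith)
  linarith

lemma swapMap_mem_right (ha : 0 < a) (hb : b < 0) (hc : a < c) (hw : w ∈ Ioo b 0) :
    swapMap a b c w ∈ Ioo a c := by
  have hd := swapMap_denom_neg_left ha hb hc hw
  obtain ⟨h1, h2⟩ := hw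
  have p1 : 0 < (-w) * ((a - b) * (c - a)) :=
    mul_pos (by linarith) (mul_pos (by linarith) (by linarith))
  have p2 : 0 < c * (c - a) * (w - b) :=
    mul_pos (mul_pos (by linarith) (by linarith)) (by linarith)
  rw [swapMap]
  constructor
  · rw [lt_div_iff_of_neg hd]; nlinarith
  · rw [div_lt_iff_of_neg hd]; nlinarith

lemma swapMap_mem_left (ha : 0 < a) (hb : b < 0) (hw : w ∈ Ioo a c) :
    swapMap a b c w ∈ Ioo b 0 := by
  have hd := swapMap_denom_neg_right ha hb hw
  obtain ⟨h1, h2⟩ := hw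
  have p1 : 0 < (-b) * (a - b) * (c - w) :=
    mul_pos (mul_pos (by linarith) (by linarith)) (by linarith)
  have p2 : 0 < (-b) * c * (w - a) :=
    mul_pos (mul_pos (by linarith) (by linarith)) (by linarith)
  rw [swapMap]
  constructor
  · rw [lt_div_iff_of_neg hd]; nlinarith
  · rw [div_lt_iff_of_neg hd]; nlinarith

lemma swapMap_mul_denom (h : (a - b - c) * w + b * c ≠ 0) :
    swapMap a b c w * ((a - b - c) * w + b * c) = b * c * (a - w) :=
  div_mul_cancel₀ _ h

lemma swapMap_swapMap (h : (a - b - c) * w + b * c ≠ 0)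
    (h' : (a - b - c) * swapMap a b c w + b * c ≠ 0) :
    swapMap a b c (swapMap a b c w) = w := by
  rw [swapMap, div_eq_iff h']
  linear_combination -swapMap_mul_denom h

lemma injOn_swapMap (ha : 0 < a) (hb : b < 0) (hc : a < c) :
    InjOn (swapMap a b c) (Ioo b 0) := by
  have h : LeftInvOn (swapMap a b c) (swapMap a b c) (Ioo b 0) := fun w hw ↦
    swapMap_swapMap (swapMap_denom_neg_left ha hb hc hw).ne
      (swapMap_denom_neg_right ha hb (swapMap_mem_right ha hb hc hw)).ne
  exact h.injOn

lemma image_swapMap (ha : 0 < a) (hb : b < 0) (hc : a < c) :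
    swapMap a b c '' Ioo b 0 = Ioo a c := by
  refine Subset.antisymm (image_subset_iff.2 fun w hw ↦ swapMap_mem_right ha hb hc hw)
    fun z hz ↦ ⟨_, swapMap_mem_left ha hb hz, ?_⟩
  exact swapMap_swapMap (swapMap_denom_neg_right ha hb hz).ne
    (swapMap_denom_neg_left ha hb hc (swapMap_mem_left ha hb hz)).ne

lemma hasDerivAt_swapMap (h : (a - b - c) * w + b * c ≠ 0) :
    HasDerivAt (swapMap a b c)
      (b * c * (a - b) * (c - a) / ((a - b - c) * w + b * c) ^ 2) w := by
  have h1 : HasDerivAt (fun w ↦ b * c * (a - w)) (b * c * (-1)) w :=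
    ((hasDerivAt_id w).const_sub a).const_mul _
  have h2 : HasDerivAt (fun w ↦ (a - b - c) * w + b * c) ((a - b - c) * 1) w :=
    ((hasDerivAt_id w).const_mul _).add_const _
  refine (h1.div h2 h).congr_deriv ?_
  congr 1
  ring

/-- The differential `dz / √(z (z - a) (z - b) (z - c))` is invariant under `swapMap`, up to sign. -/
lemma swapMap_quartic (h : (a - b - c) * w + b * c ≠ 0) :
    swapMap a b c w * (swapMap a b c w - a) * (swapMap a b c w - b) * (swapMap a b c w - c) =
      (b * c * (a - b) * (c - a) / ((a - b - c) * w + b * c) ^ 2) ^ 2 *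
        (w * (w - a) * (w - b) * (w - c)) := by
  have hφ := swapMap_mul_denom h
  have e1 : swapMap a b c w = b * c * (a - w) / ((a - b - c) * w + b * c) := rfl
  have e2 : swapMap a b c w - a = w * (a - b) * (c - a) / ((a - b - c) * w + b * c) := by
    rw [eq_div_iff h]; linear_combination hφ
  have e3 : swapMap a b c w - b = b * (a - b) * (c - w) / ((a - b - c) * w + b * c) := by
    rw [eq_div_iff h]; linear_combination hφ
  have e4 : swapMap a b c w - c = c * (c - a) * (w - b) / ((a - b - c) * w + b * c) := by
    rw [eq_div_iff h]; linear_combination hφ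
  rw [e2, e3, e4, e1]
  generalize (a - b - c) * w + b * c = d
  ring

end swapMap

lemma intervalIntegrable_one_div_sqrt_quintic {a b c r : ℝ} (ha : 0 < a) (hb : b < 0) (hc : a < c)
    (hr : r < b) :
    IntervalIntegrable (fun z ↦ 1 / √(-z * (z - a) * (z - r) * (z - b) * (z - c))) volume b 0 := by
  have hs : IntervalIntegrable (fun x : ℝ ↦ x ^ (-(1 / 2) : ℝ)) volume 0 (-b) :=
    intervalIntegral.intervalIntegrable_rpow' (by norm_num)
  have hx : IntervalIntegrable (fun z : ℝ ↦ (-z) ^ (-(1 / 2) : ℝ)) volume b 0 := by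
    have := (hs.comp_sub_left 0).symm
    simpa using this
  have hy : IntervalIntegrable (fun z : ℝ ↦ (z - b) ^ (-(1 / 2) : ℝ)) volume b 0 := by
    simpa using hs.comp_sub_right b
  have hR : ∀ z ∈ uIcc b 0, 0 < (a - z) * (c - z) * (z - r) := by
    intro z hz
    rw [uIcc_of_le hb.le] at hz
    exact mul_pos (mul_pos (by linarith [hz.2]) (by linarith [hz.2])) (by linarith [hz.1])
  have hcx : ContinuousOn (fun z ↦ √(-z) / (-b * √((a - z) * (c - z) * (z - r)))) (uIcc b 0) := by
    refine ContinuousOn.div (by fun_prop) (by fun_prop) fun z hz ↦ ?_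
    exact mul_ne_zero (by linarith) (Real.sqrt_pos.2 (hR z hz)).ne'
  have hcy : ContinuousOn (fun z ↦ √(z - b) / (-b * √((a - z) * (c - z) * (z - r))))
      (uIcc b 0) := by
    refine ContinuousOn.div (by fun_prop) (by fun_prop) fun z hz ↦ ?_
    exact mul_ne_zero (by linarith) (Real.sqrt_pos.2 (hR z hz)).ne'
  have key := (hy.continuousOn_mul hcx).add (hx.continuousOn_mul hcy)
  rw [intervalIntegrable_iff_integrableOn_Ioo_of_le hb.le] at key ⊢
  refine key.congr_fun (fun z hz ↦ ?_) measurableSet_Ioo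
  have hz' : z ∈ uIcc b 0 := by rw [uIcc_of_le hb.le]; exact Ioo_subset_Icc_self hz
  have h1 : 0 < -z := by linarith [hz.2]
  have h2 : 0 < z - b := by linarith [hz.1]
  have hs1 := Real.sqrt_pos.2 h1
  have hs2 := Real.sqrt_pos.2 h2
  have hs3 := Real.sqrt_pos.2 (hR z hz')
  have e : -z * (z - a) * (z - r) * (z - b) * (z - c) =
      (-z) * (z - b) * ((a - z) * (c - z) * (z - r)) := by ring
  have q1 := Real.mul_self_sqrt h1.le
  have q2 := Real.mul_self_sqrt h2.le
  beta_reduce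
  rw [e, Real.sqrt_mul (mul_pos h1 h2).le, Real.sqrt_mul h1.le, Real.rpow_neg h1.le,
    Real.rpow_neg h2.le, ← Real.sqrt_eq_rpow, ← Real.sqrt_eq_rpow]
  generalize √((a - z) * (c - z) * (z - r)) = R at *
  generalize √(-z) = x at *
  generalize √(z - b) = y at *
  have hb' : -b = x * x + y * y := by linarith
  have : x * x + y * y ≠ 0 := by positivity
  rw [hb']
  field_simp

lemma abs_deriv_mul_one_div_sqrt_quintic_lt {a b c r w : ℝ} (ha : 0 < a) (hb : b < 0) (hc : a < c)
    (hr : r < b) (hw : w ∈ Ioo b 0) :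
    |b * c * (a - b) * (c - a) / ((a - b - c) * w + b * c) ^ 2| *
      (1 / √(-swapMap a b c w * (swapMap a b c w - a) * (swapMap a b c w - r) *
        (swapMap a b c w - b) * (swapMap a b c w - c))) <
      1 / √(-w * (w - a) * (w - r) * (w - b) * (w - c)) := by
  have hd := swapMap_denom_neg_left ha hb hc hw
  have hm := swapMap_mem_right ha hb hc hw
  have hq := swapMap_quartic hd.ne
  have hD : b * c * (a - b) * (c - a) / ((a - b - c) * w + b * c) ^ 2 ≠ 0 :=
    div_ne_zero (mul_ne_zero (mul_ne_zero (mul_ne_zero hb.ne (by linarith)) (by linarith))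
      (by linarith)) (pow_ne_zero _ hd.ne)
  generalize b * c * (a - b) * (c - a) / ((a - b - c) * w + b * c) ^ 2 = D at *
  generalize swapMap a b c w = z at *
  obtain ⟨h1, h2⟩ := hw
  have hQ : 0 < -w * (a - w) * (w - b) * (c - w) :=
    mul_pos (mul_pos (mul_pos (by linarith) (by linarith)) (by linarith)) (by linarith)
  have ez : -z * (z - a) * (z - r) * (z - b) * (z - c) =
      D ^ 2 * ((-w * (a - w) * (w - b) * (c - w)) * (z - r)) := by
    linear_combination (-(z - r)) * hq
  have ew : -w * (w - a) * (w - r) * (w - b) * (w - c) =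
      (-w * (a - w) * (w - b) * (c - w)) * (w - r) := by ring
  have hD' : |D| ≠ 0 := abs_ne_zero.2 hD
  rw [ez, ew, Real.sqrt_mul (sq_nonneg D), Real.sqrt_sq_eq_abs, mul_one_div,
    div_mul_cancel_left₀ hD', ← one_div]
  refine one_div_lt_one_div_of_lt (Real.sqrt_pos.2 (mul_pos hQ (by linarith))) ?_
  exact Real.sqrt_lt_sqrt (mul_pos hQ (by linarith)).le
    (mul_lt_mul_of_pos_left (by linarith [hm.1]) hQ)

lemma integral_one_div_sqrt_quintic_lt {a b c r : ℝ} (ha : 0 < a) (hb : b < 0) (hc : a < c)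
    (hr : r < b) :
    (∫ z in a..c, 1 / √(-z * (z - a) * (z - r) * (z - b) * (z - c))) <
      ∫ z in b..0, 1 / √(-z * (z - a) * (z - r) * (z - b) * (z - c)) := by
  set F : ℝ → ℝ := fun z ↦ 1 / √(-z * (z - a) * (z - r) * (z - b) * (z - c)) with hF
  have hint : IntegrableOn F (Ioo b 0) :=
    (intervalIntegrable_iff_integrableOn_Ioo_of_le hb.le).1
      (intervalIntegrable_one_div_sqrt_quintic ha hb hc hr)
  set D : ℝ → ℝ := fun w ↦ b * c * (a - b) * (c - a) / ((a - b - c) * w + b * c) ^ 2 with hDdef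
  have hlt : ∀ w ∈ Ioo b 0, |D w| * F (swapMap a b c w) < F w := fun w hw ↦
    abs_deriv_mul_one_div_sqrt_quintic_lt ha hb hc hr hw
  have hmeas : Measurable fun w ↦ |D w| * F (swapMap a b c w) := by
    simp only [hF, hDdef, swapMap]
    fun_prop
  have hint' : IntegrableOn (fun w ↦ |D w| * F (swapMap a b c w)) (Ioo b 0) := by
    refine Integrable.mono' hint hmeas.aestronglyMeasurable ?_
    refine (ae_restrict_iff' measurableSet_Ioo).2 (.of_forall fun w hw ↦ ?_)
    rw [Real.norm_of_nonneg (by positivity)]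
    exact (hlt w hw).le
  rw [intervalIntegral.integral_of_le hc.le, intervalIntegral.integral_of_le hb.le,
    integral_Ioc_eq_integral_Ioo, integral_Ioc_eq_integral_Ioo, ← image_swapMap ha hb hc,
    integral_image_eq_integral_abs_deriv_smul measurableSet_Ioo
      (fun w hw ↦ (hasDerivAt_swapMap (swapMap_denom_neg_left ha hb hc hw).ne).hasDerivWithinAt)
      (injOn_swapMap ha hb hc)]
  simp only [smul_eq_mul]
  rw [← sub_pos, ← integral_sub hint hint',
    setIntegral_pos_iff_support_of_nonneg_ae
      ((ae_restrict_iff' measurableSet_Ioo).2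
        (.of_forall fun w hw ↦ (sub_pos.2 (hlt w hw)).le)) (hint.sub hint')]
  refine lt_of_lt_of_le ?_ (measure_mono fun w hw ↦ ⟨(sub_pos.2 (hlt w hw)).ne', hw⟩)
  simpa using hb

theorem stmt_18 (κ r₁ r₂ r₃ : ℝ) (hκ : 0 < κ) (hκ' : κ < 1/4)
    (h₁₂ : r₁ < r₂) (h₂ : r₂ < 0) (h₃ : 2 * Real.sqrt κ < r₃) :
    (∫ z in (2 * Real.sqrt κ)..r₃,
        1 / Real.sqrt (-z * (z - 2 * Real.sqrt κ) * (z - r₁) * (z - r₂) * (z - r₃))) <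
    (∫ z in r₂..(0:ℝ),
        1 / Real.sqrt (-z * (z - 2 * Real.sqrt κ) * (z - r₁) * (z - r₂) * (z - r₃))) := by
  exact integral_one_div_sqrt_quintic_lt (by positivity) h₂ h₃ h₁₂
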